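/- Let S = {λ ∈ W^odd : there exists a chain of degree d ≤ (1^m) from the identity coset to λ}. Then the set of maximal elements of S with respect to the order ⪯ is exactly {δ¹, δ², …, δ^m}. -/

import Mathlib

/-- Roots of `R⁺ \ R_P⁺`: the formal symbols `t_i - t_j`, `t_i + t_j` and `2 t_i`. -/
inductive OddRoot : Type where
  | tminus (i j : ℕ) : OddRoot
  | tplus (i j : ℕ) : OddRoot
  | double (i : ℕ) : OddRoot
deriving DecidableEq

namespace OddRoot

/-- The conditions for a formal symbol to be a root of `R⁺ \ R_P⁺`. -/
def valid (n m : ℕ) : OddRoot → Prop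
  | tminus i j => 1 ≤ i ∧ i ≤ m ∧ i < j ∧ j ≤ n + 1
  | tplus i j => 1 ≤ i ∧ i ≤ m ∧ i < j ∧ j ≤ n + 1
  | double i => 1 ≤ i ∧ i ≤ m

/-- The reflection associated to a root, as a (signed) permutation of the
ground set `{1,…,2n+2}` inside `ℕ`, where `ī = 2n+3-i`. -/
def refl (n : ℕ) : OddRoot → Equiv.Perm ℕ
  | tminus i j => Equiv.swap i j * Equiv.swap (2*n+3-i) (2*n+3-j)
  | tplus i j => Equiv.swap i (2*n+3-j) * Equiv.swap j (2*n+3-i)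
  | double i => Equiv.swap i (2*n+3-i)

/-- The degree vector of a root: `deg α k` is the coefficient of the `k`-th
simple coroot in `α∨`. -/
def deg : OddRoot → ℕ → ℤ
  | tminus i j, k => if i ≤ k ∧ k < j then 1 else 0
  | tplus i j, k => (if i ≤ k then (1:ℤ) else 0) + (if j ≤ k then 1 else 0)
  | double i, k => if i ≤ k then 1 else 0

end OddRoot

/-- The total degree of a chain of roots. -/
def chainDeg (L : List OddRoot) (k : ℕ) : ℤ := (L.map (fun α => α.deg k)).sum

/-- `IsChainTo n m L lam` : the sequence of roots `L = [α₁,…,α_t]` is a chain from the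
identity coset to the tuple `lam`, i.e. each `αᵢ` is in `R⁺ \ R_P⁺` and the composite
`w = s_{α₁} ∘ ⋯ ∘ s_{α_t}` satisfies `w i = lam i` for `1 ≤ i ≤ m`. -/
def IsChainTo (n m : ℕ) (L : List OddRoot) (lam : ℕ → ℕ) : Prop :=
  (∀ α ∈ L, α.valid n m) ∧
  ∀ i ∈ Finset.Icc 1 m, ((L.map (OddRoot.refl n)).prod) i = lam i

/-- `W^odd`: tuples `(lam 1, …, lam m)` of pairwise distinct elements of `{1,…,2n+1}`
with no two entries summing to `2n+3`. -/
def Wodd (n m : ℕ) (lam : ℕ → ℕ) : Prop :=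
  (∀ i ∈ Finset.Icc 1 m, lam i ∈ Finset.Icc 1 (2*n+1)) ∧
  (∀ i ∈ Finset.Icc 1 m, ∀ j ∈ Finset.Icc 1 m, i ≠ j → lam i ≠ lam j) ∧
  (∀ i ∈ Finset.Icc 1 m, ∀ j ∈ Finset.Icc 1 m, lam i + lam j ≠ 2*n+3)

/-- `LamEntry lam k i = Λᵏᵢ`, the `i`-th smallest element of `{lam 1, …, lam k}`. -/
def LamEntry (lam : ℕ → ℕ) (k i : ℕ) : ℕ :=
  (((Finset.Icc 1 k).image lam).sort (· ≤ ·)).getD (i-1) 0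

/-- The Bruhat-type order `λ ⪯ δ`: `Λᵏᵢ ≤ Δᵏᵢ` for all `1 ≤ i ≤ k ≤ m`. -/
def Dominates (m : ℕ) (lam del : ℕ → ℕ) : Prop :=
  ∀ k ∈ Finset.Icc 1 m, ∀ i ∈ Finset.Icc 1 k, LamEntry lam k i ≤ LamEntry del k i

/-- The tuples `δʲ`: `δ¹ = ((m+1)̄ | 2 | 3 | ⋯ | m)` and, for `2 ≤ j ≤ m`,
`δʲ = (j̄ | 2 | ⋯ | j-1 | 1 | j+1 | ⋯ | m)`. -/
def delta (n m j : ℕ) : ℕ → ℕ := fun i =>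
  if j = 1 then (if i = 1 then 2*n+2-m else i)
  else if i = 1 then 2*n+3-j else if i = j then 1 else i

/-- The pattern vector `(0^a 1^b c^(m-a-b))`. -/
def patvec (a b : ℕ) (c : ℤ) : ℕ → ℤ := fun k =>
  if k ≤ a then 0 else if k ≤ a + b then 1 else c

/-- The simple reflections `s_k` (`1 ≤ k ≤ n`, swapping `k ↔ k+1` and `k̄ ↔ (k+1)̄`)
and `s_{n+1}` (swapping `n+1 ↔ (n+1)̄ = n+2`). -/
def simpleRefl (n k : ℕ) : Equiv.Perm ℕ :=
  if k ≤ n then Equiv.swap k (k+1) * Equiv.swap (2*n+3-k) (2*n+2-k)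
  else Equiv.swap (n+1) (n+2)

/-- One reflection moves at most `deg α k` elements of `[1,k]` out of `[1,k]`. -/
theorem refl_image_sdiff (n m k : ℕ) (hmn : m ≤ n) (hk : k ≤ m) (α : OddRoot)
    (hα : α.valid n m) :
    (((((Finset.Icc 1 k).image (α.refl n)) \ Finset.Icc 1 k).card : ℕ) : ℤ) ≤ α.deg k := by
  cases α with
  | tminus i j =>
    obtain ⟨h1, h2, h3, h4⟩ := hα
    by_cases hc : i ≤ k ∧ k < j
    · have hs : ((Finset.Icc 1 k).image ((OddRoot.tminus i j).refl n)) \ Finset.Icc 1 k ⊆ {j} := by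
        intro x hx
        simp only [Finset.mem_sdiff, Finset.mem_image, Finset.mem_Icc, OddRoot.refl,
          Equiv.Perm.mul_apply, Equiv.swap_apply_def] at hx
        obtain ⟨⟨a, ha, hax⟩, hx2⟩ := hx
        simp only [Finset.mem_singleton]
        split_ifs at hax <;> omega
      have := Finset.card_le_card hs
      simp only [OddRoot.deg, hc, and_self, if_true]
      simpa using this
    · have hs : ((Finset.Icc 1 k).image ((OddRoot.tminus i j).refl n)) \ Finset.Icc 1 k ⊆ ∅ := by
        intro x hx
        simp only [Finset.mem_sdiff, Finset.mem_image, Finset.mem_Icc, OddRoot.refl,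
          Equiv.Perm.mul_apply, Equiv.swap_apply_def] at hx
        obtain ⟨⟨a, ha, hax⟩, hx2⟩ := hx
        exfalso
        split_ifs at hax <;> omega
      have := Finset.card_le_card hs
      simp only [OddRoot.deg, hc, if_false]
      simpa using this
  | tplus i j =>
    obtain ⟨h1, h2, h3, h4⟩ := hα
    have hs : ((Finset.Icc 1 k).image ((OddRoot.tplus i j).refl n)) \ Finset.Icc 1 k ⊆
        (if i ≤ k then {2*n+3-j} else ∅) ∪ (if j ≤ k then {2*n+3-i} else ∅) := by
      intro x hx
      simp only [Finset.mem_sdiff, Finset.mem_image, Finset.mem_Icc, OddRoot.refl,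
        Equiv.Perm.mul_apply, Equiv.swap_apply_def] at hx
      obtain ⟨⟨a, ha, hax⟩, hx2⟩ := hx
      split_ifs <;> simp <;> split_ifs at hax <;> omega
    have h5 := (Finset.card_le_card hs).trans (Finset.card_union_le _ _)
    simp only [OddRoot.deg]
    split_ifs at h5 ⊢ <;> simp at h5 ⊢ <;> omega
  | double i =>
    obtain ⟨h1, h2⟩ := hα
    have hs : ((Finset.Icc 1 k).image ((OddRoot.double i).refl n)) \ Finset.Icc 1 k ⊆
        (if i ≤ k then {2*n+3-i} else ∅) := by
      intro x hx
      simp only [Finset.mem_sdiff, Finset.mem_image, Finset.mem_Icc, OddRoot.refl,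
        Equiv.swap_apply_def] at hx
      obtain ⟨⟨a, ha, hax⟩, hx2⟩ := hx
      split_ifs <;> simp <;> split_ifs at hax <;> omega
    have h5 := Finset.card_le_card hs
    simp only [OddRoot.deg]
    split_ifs at h5 ⊢ <;> simp at h5 ⊢ <;> omega

theorem chain_image_sdiff (n m k : ℕ) (hmn : m ≤ n) (hk : k ≤ m) (L : List OddRoot)
    (hL : ∀ α ∈ L, α.valid n m) :
    (((((Finset.Icc 1 k).image ((L.map (OddRoot.refl n)).prod)) \ Finset.Icc 1 k).card : ℕ) : ℤ)
      ≤ chainDeg L k := by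
  induction L with
  | nil => simp [chainDeg]
  | cons α L ih =>
    have ih := ih (fun β hβ => hL β (List.mem_cons_of_mem _ hβ))
    have h1 := refl_image_sdiff n m k hmn hk α (hL α (by simp))
    set w := (L.map (OddRoot.refl n)).prod with hw
    have hs : ((Finset.Icc 1 k).image (((α :: L).map (OddRoot.refl n)).prod)) \ Finset.Icc 1 k ⊆
        (((Finset.Icc 1 k).image w) \ Finset.Icc 1 k).image (α.refl n) ∪
        (((Finset.Icc 1 k).image (α.refl n)) \ Finset.Icc 1 k) := by
      intro x hx
      simp only [List.map_cons, List.prod_cons, ← hw, Finset.mem_sdiff, Finset.mem_image,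
        Equiv.Perm.mul_apply] at hx
      obtain ⟨⟨a, ha, rfl⟩, hx2⟩ := hx
      by_cases hc : w a ∈ Finset.Icc 1 k
      · exact Finset.mem_union_right _
          (Finset.mem_sdiff.2 ⟨Finset.mem_image_of_mem _ hc, hx2⟩)
      · exact Finset.mem_union_left _ (Finset.mem_image_of_mem _
          (Finset.mem_sdiff.2 ⟨Finset.mem_image_of_mem _ ha, hc⟩))
    have h2 := (Finset.card_le_card hs).trans (Finset.card_union_le _ _)
    have h3 : ((((Finset.Icc 1 k).image w) \ Finset.Icc 1 k).image (α.refl n)).card ≤ _ :=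
      Finset.card_image_le
    have h4 : chainDeg (α :: L) k = α.deg k + chainDeg L k := by simp [chainDeg]
    rw [h4]
    omega

theorem refl_symm (n m : ℕ) (hmn : m ≤ n) (α : OddRoot) (hα : α.valid n m) (x : ℕ)
    (hx1 : 1 ≤ x) (hx2 : x ≤ 2*n+2) :
    1 ≤ α.refl n x ∧ α.refl n x ≤ 2*n+2 ∧ α.refl n (2*n+3-x) = 2*n+3 - α.refl n x := by
  cases α with
  | tminus i j =>
    obtain ⟨h1, h2, h3, h4⟩ := hα
    simp only [OddRoot.refl, Equiv.Perm.mul_apply, Equiv.swap_apply_def]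
    refine ⟨?_, ?_, ?_⟩ <;> split_ifs <;> omega
  | tplus i j =>
    obtain ⟨h1, h2, h3, h4⟩ := hα
    simp only [OddRoot.refl, Equiv.Perm.mul_apply, Equiv.swap_apply_def]
    refine ⟨?_, ?_, ?_⟩ <;> split_ifs <;> omega
  | double i =>
    obtain ⟨h1, h2⟩ := hα
    simp only [OddRoot.refl, Equiv.swap_apply_def]
    refine ⟨?_, ?_, ?_⟩ <;> split_ifs <;> omega

theorem chain_symm (n m : ℕ) (hmn : m ≤ n) (L : List OddRoot)
    (hL : ∀ α ∈ L, α.valid n m) (x : ℕ) (hx1 : 1 ≤ x) (hx2 : x ≤ 2*n+2) :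
    1 ≤ (L.map (OddRoot.refl n)).prod x ∧ (L.map (OddRoot.refl n)).prod x ≤ 2*n+2 ∧
    (L.map (OddRoot.refl n)).prod (2*n+3-x) = 2*n+3 - (L.map (OddRoot.refl n)).prod x := by
  induction L with
  | nil => simp; omega
  | cons α L ih =>
    obtain ⟨a1, a2, a3⟩ := ih (fun β hβ => hL β (List.mem_cons_of_mem _ hβ))
    obtain ⟨b1, b2, b3⟩ := refl_symm n m hmn α (hL α (by simp)) _ a1 a2
    simp only [List.map_cons, List.prod_cons, Equiv.Perm.mul_apply]
    rw [a3]
    exact ⟨b1, b2, b3⟩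

/-- Sorted entries in terms of counting. -/
theorem sort_getD_le_iff (U : Finset ℕ) (i v : ℕ) (hi : i < U.card) :
    (U.sort (· ≤ ·)).getD i 0 ≤ v ↔ i + 1 ≤ (U.filter (· ≤ v)).card := by
  have hfin : {x | x ∈ U}.Finite := U.finite_toSet
  have hU : hfin.toFinset = U := by ext; simp
  have hn : (U.sort (· ≤ ·)).getD i 0 = Nat.nth (· ∈ U) i := by
    rw [Nat.nth_eq_getD_sort hfin, hU]
  have hc : (U.filter (· ≤ v)).card = Nat.count (· ∈ U) (v+1) := by
    rw [Nat.count_eq_card_filter_range]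
    congr 1
    ext x
    simp only [Finset.mem_filter, Finset.mem_range, Nat.lt_succ_iff]
    tauto
  rw [hn, hc]
  have hi' : ∀ h : {x | x ∈ U}.Finite, i < h.toFinset.card := by
    intro h
    have : h.toFinset = U := by ext; simp
    rwa [this]
  constructor
  · intro h
    have h1 : Nat.count (· ∈ U) (Nat.nth (· ∈ U) i + 1) = i + 1 := Nat.count_nth_succ hi'
    rw [← h1]
    exact Nat.count_monotone _ (by omega)
  · intro h
    have := Nat.nth_lt_of_lt_count (p := (· ∈ U)) (n := v+1) (k := i) (by omega)
    omega

theorem card_image_inj (k m : ℕ) (hk : k ≤ m) (f : ℕ → ℕ)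
    (hf : ∀ i ∈ Finset.Icc 1 m, ∀ j ∈ Finset.Icc 1 m, i ≠ j → f i ≠ f j) :
    ((Finset.Icc 1 k).image f).card = k := by
  rw [Finset.card_image_of_injOn]
  · simp
  · intro a ha b hb hab
    simp only [Finset.coe_Icc, Set.mem_Icc] at ha hb
    by_contra hne
    exact hf a (by simp; omega) b (by simp; omega) hne hab

theorem lamEntry_le_iff (k m i v : ℕ) (hk : k ≤ m) (hi : i ∈ Finset.Icc 1 k) (f : ℕ → ℕ)
    (hf : ∀ i ∈ Finset.Icc 1 m, ∀ j ∈ Finset.Icc 1 m, i ≠ j → f i ≠ f j) :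
    LamEntry f k i ≤ v ↔ i ≤ (((Finset.Icc 1 k).image f).filter (· ≤ v)).card := by
  have hc := card_image_inj k m hk f hf
  simp only [Finset.mem_Icc] at hi
  unfold LamEntry
  rw [sort_getD_le_iff _ _ _ (by omega)]
  omega

theorem dominates_of_count (m : ℕ) (f g : ℕ → ℕ)
    (hf : ∀ i ∈ Finset.Icc 1 m, ∀ j ∈ Finset.Icc 1 m, i ≠ j → f i ≠ f j)
    (hg : ∀ i ∈ Finset.Icc 1 m, ∀ j ∈ Finset.Icc 1 m, i ≠ j → g i ≠ g j)
    (h : ∀ k, 1 ≤ k → k ≤ m → ∀ v, (((Finset.Icc 1 k).image g).filter (· ≤ v)).card ≤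
      (((Finset.Icc 1 k).image f).filter (· ≤ v)).card) : Dominates m f g := by
  intro k hk i hi
  rw [Finset.mem_Icc] at hk
  rw [lamEntry_le_iff k m i _ hk.2 hi f hf]
  exact ((lamEntry_le_iff k m i _ hk.2 hi g hg).1 le_rfl).trans (h k hk.1 hk.2 _)

theorem dominates_antisymm (m : ℕ) (f g : ℕ → ℕ)
    (hf : ∀ i ∈ Finset.Icc 1 m, ∀ j ∈ Finset.Icc 1 m, i ≠ j → f i ≠ f j)
    (hg : ∀ i ∈ Finset.Icc 1 m, ∀ j ∈ Finset.Icc 1 m, i ≠ j → g i ≠ g j)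
    (h1 : Dominates m f g) (h2 : Dominates m g f) : ∀ i ∈ Finset.Icc 1 m, f i = g i := by
  have himg : ∀ k, k ≤ m → (Finset.Icc 1 k).image f = (Finset.Icc 1 k).image g := by
    intro k hk
    have cf := card_image_inj k m hk f hf
    have cg := card_image_inj k m hk g hg
    have hl : ((Finset.Icc 1 k).image f).sort (· ≤ ·) = ((Finset.Icc 1 k).image g).sort (· ≤ ·) := by
      apply List.ext_getElem
      · simp [cf, cg]
      · intro i hi1 hi2
        have hik : i < k := by simpa [cf] using hi1
        have e := le_antisymm (h1 k (by simp; omega) (i+1) (by simp; omega))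
          (h2 k (by simp; omega) (i+1) (by simp; omega))
        unfold LamEntry at e
        simp only [Nat.add_sub_cancel] at e
        rwa [List.getD_eq_getElem _ _ hi1, List.getD_eq_getElem _ _ hi2] at e
    have := congrArg List.toFinset hl
    simpa using this
  intro k hk
  have hk' := Finset.mem_Icc.1 hk
  have h3 : f k ∈ (Finset.Icc 1 k).image g := by
    rw [← himg k hk'.2]
    exact Finset.mem_image_of_mem _ (by simp; omega)
  obtain ⟨a, ha, hak⟩ := Finset.mem_image.1 h3
  rw [Finset.mem_Icc] at ha
  by_cases hc : a = k
  · rw [← hak, hc]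
  · exfalso
    have h4 : f k ∈ (Finset.Icc 1 (k-1)).image f := by
      rw [himg (k-1) (by omega), ← hak]
      exact Finset.mem_image_of_mem _ (by simp; omega)
    obtain ⟨b, hb, hbk⟩ := Finset.mem_image.1 h4
    rw [Finset.mem_Icc] at hb
    exact hf b (by simp; omega) k hk (by omega) hbk

theorem dominates_congr (m : ℕ) (f f' g g' : ℕ → ℕ)
    (hf : ∀ i ∈ Finset.Icc 1 m, f i = f' i) (hg : ∀ i ∈ Finset.Icc 1 m, g i = g' i)
    (h : Dominates m f g) : Dominates m f' g' := by
  intro k hk i hi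
  have key : ∀ a b : ℕ → ℕ, (∀ i ∈ Finset.Icc 1 m, a i = b i) → LamEntry a k i = LamEntry b k i := by
    intro a b hab
    have : (Finset.Icc 1 k).image a = (Finset.Icc 1 k).image b := by
      apply Finset.image_congr
      intro x hx
      simp only [Finset.coe_Icc, Set.mem_Icc] at hx
      simp only [Finset.mem_Icc] at hk
      exact hab x (by simp; omega)
    unfold LamEntry
    rw [this]
  rw [← key f f' hf, ← key g g' hg]
  exact h k hk i hi

theorem delta_wodd (n m j : ℕ) (hm : 1 ≤ m) (hmn : m ≤ n) (hj : 1 ≤ j) (hjm : j ≤ m) :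
    Wodd n m (delta n m j) := by
  refine ⟨?_, ?_, ?_⟩
  · intro i hi
    simp only [Finset.mem_Icc, delta] at *
    split_ifs <;> omega
  · intro i hi k hk hik
    simp only [Finset.mem_Icc, delta] at *
    split_ifs <;> omega
  · intro i hi k hk
    simp only [Finset.mem_Icc, delta] at *
    split_ifs <;> omega

theorem delta_chain (n m j : ℕ) (hm : 1 ≤ m) (hmn : m ≤ n) (hj : 1 ≤ j) (hjm : j ≤ m) :
    ∃ L : List OddRoot, IsChainTo n m L (delta n m j) ∧
      ∀ k ∈ Finset.Icc 1 m, chainDeg L k ≤ 1 := by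
  by_cases h : j = 1
  · refine ⟨[OddRoot.tplus 1 (m+1)], ⟨?_, ?_⟩, ?_⟩
    · simp [OddRoot.valid]; omega
    · intro i hi
      simp only [Finset.mem_Icc] at hi
      simp only [List.map_cons, List.map_nil, List.prod_cons, List.prod_nil, mul_one, OddRoot.refl,
        Equiv.Perm.mul_apply, Equiv.swap_apply_def, delta]
      split_ifs <;> omega
    · intro k hk
      simp only [Finset.mem_Icc] at hk
      simp only [chainDeg, List.map_cons, List.map_nil, List.sum_cons, List.sum_nil, OddRoot.deg]
      split_ifs <;> omega
  · refine ⟨[OddRoot.double j, OddRoot.tminus 1 j], ⟨?_, ?_⟩, ?_⟩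
    · simp [OddRoot.valid]; omega
    · intro i hi
      simp only [Finset.mem_Icc] at hi
      simp only [List.map_cons, List.map_nil, List.prod_cons, List.prod_nil, mul_one, OddRoot.refl,
        Equiv.Perm.mul_apply, Equiv.swap_apply_def, delta]
      split_ifs <;> omega
    · intro k hk
      simp only [Finset.mem_Icc] at hk
      simp only [chainDeg, List.map_cons, List.map_nil, List.sum_cons, List.sum_nil, OddRoot.deg]
      split_ifs <;> omega

theorem lamEntry_one (f : ℕ → ℕ) : LamEntry f 1 1 = f 1 := by
  simp [LamEntry]

theorem delta_incomp (n m j j' : ℕ) (hmn : m ≤ n) (hj : 1 ≤ j) (hjm : j ≤ m)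
    (hj' : 1 ≤ j') (hjm' : j' ≤ m) (h : Dominates m (delta n m j) (delta n m j')) : j = j' := by
  by_contra hne
  have hm : 1 ≤ m := by omega
  have h1 := h 1 (by simp; omega) 1 (by simp)
  rw [lamEntry_one, lamEntry_one] at h1
  have h2 : 2 ≤ j' ∧ (j = 1 ∨ j' < j) := by
    simp only [delta, if_true] at h1
    split_ifs at h1 <;> omega
  have h3 := h j' (by simp; omega) 1 (by simp; omega)
  have h4 : LamEntry (delta n m j') j' 1 ≤ 1 := by
    rw [lamEntry_le_iff j' m 1 1 hjm' (by simp; omega) _ (delta_wodd n m j' hm hmn hj' hjm').2.1]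
    apply Finset.card_pos.2
    refine ⟨1, Finset.mem_filter.2 ⟨Finset.mem_image.2 ⟨j', by simp; omega, ?_⟩, le_rfl⟩⟩
    simp only [delta]
    split_ifs <;> omega
  have h5 := h3.trans h4
  rw [lamEntry_le_iff j' m 1 1 hjm' (by simp; omega) _ (delta_wodd n m j hm hmn hj hjm).2.1] at h5
  obtain ⟨x, hx⟩ := Finset.card_pos.1 h5
  simp only [Finset.mem_filter, Finset.mem_image, Finset.mem_Icc, delta] at hx
  obtain ⟨⟨a, ha, hax⟩, hx1⟩ := hx
  split_ifs at hax <;> omega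

/-- Every reachable tuple lies below some `δʲ`. -/
theorem exists_delta_ge (n m : ℕ) (hm : 1 ≤ m) (hmn : m ≤ n) (lam : ℕ → ℕ)
    (hW : Wodd n m lam) (L : List OddRoot) (hL : IsChainTo n m L lam)
    (hd : ∀ k ∈ Finset.Icc 1 m, chainDeg L k ≤ 1) :
    ∃ j, 1 ≤ j ∧ j ≤ m ∧ Dominates m lam (delta n m j) := by
  obtain ⟨hv, hw⟩ := hL
  have hsym := chain_symm n m hmn L hv
  have hcr := fun k hk => chain_image_sdiff n m k hmn hk L hv
  set w := (L.map (OddRoot.refl n)).prod with hwdef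
  obtain ⟨hW1, hW2, hW3⟩ := hW
  -- at most one element of `[1,k]` is missing from the image
  have hmiss : ∀ k, 1 ≤ k → k ≤ m →
      (Finset.Icc 1 k \ (Finset.Icc 1 k).image lam).card ≤ 1 := by
    intro k hk1 hk
    have e : (Finset.Icc 1 k).image lam = (Finset.Icc 1 k).image w := by
      apply Finset.image_congr
      intro x hx
      simp only [Finset.coe_Icc, Set.mem_Icc] at hx
      exact (hw x (by simp; omega)).symm
    have h1 := hcr k hk
    have h2 := hd k (by simp; omega)
    have h3 : (Finset.Icc 1 k \ (Finset.Icc 1 k).image w).card =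
        ((Finset.Icc 1 k).image w \ Finset.Icc 1 k).card := by
      apply Finset.card_sdiff_comm
      rw [Finset.card_image_of_injective _ w.injective]
    rw [e, h3]
    omega
  -- generic comparison
  have hgen : ∀ (j M : ℕ), 1 ≤ j → j ≤ m → M = delta n m j 1 → (∀ i ∈ Finset.Icc 1 m, lam i ≤ M) →
      (∀ k, 1 ≤ k → k ≤ m → 2 ≤ j → j ≤ k → j ∉ (Finset.Icc 1 k).image lam) →
      Dominates m lam (delta n m j) := by
    intro j M hj hjm hM hmax hjmiss
    have hdi := (delta_wodd n m j hm hmn hj hjm).2.1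
    apply dominates_of_count m _ _ hW2 hdi
    intro k hk1 hk v
    have cf := card_image_inj k m hk lam hW2
    have cg := card_image_inj k m hk _ hdi
    have hms := hmiss k hk1 hk
    by_cases hvM : M ≤ v
    · have : ((Finset.Icc 1 k).image lam).filter (· ≤ v) = (Finset.Icc 1 k).image lam := by
        apply Finset.filter_true_of_mem
        intro x hx
        obtain ⟨a, ha, rfl⟩ := Finset.mem_image.1 hx
        rw [Finset.mem_Icc] at ha
        exact (hmax a (by simp; omega)).trans hvM
      rw [this, cf]
      exact (Finset.card_filter_le _ _).trans cg.le
    · by_cases hjk : 2 ≤ j ∧ j ≤ k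
      · apply Finset.card_le_card
        intro x hx
        simp only [Finset.mem_filter, Finset.mem_image, Finset.mem_Icc] at hx
        obtain ⟨⟨a, ha, hax⟩, hxv⟩ := hx
        have hx' : x ∈ Finset.Icc 1 k ∧ x ≠ j := by
          rw [Finset.mem_Icc]
          simp only [delta] at hax hM
          split_ifs at hax hM <;> omega
        refine Finset.mem_filter.2 ⟨?_, hxv⟩
        by_contra hxn
        have hjn := hjmiss k hk1 hk hjk.1 hjk.2
        exact hx'.2 (Finset.card_le_one.1 hms x (Finset.mem_sdiff.2 ⟨hx'.1, hxn⟩) j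
          (Finset.mem_sdiff.2 ⟨by simp; omega, hjn⟩))
      · have hs : ((Finset.Icc 1 k).image (delta n m j)).filter (· ≤ v) ⊆
            Finset.Icc 2 (min k v) := by
          intro x hx
          simp only [Finset.mem_filter, Finset.mem_image, Finset.mem_Icc] at hx ⊢
          obtain ⟨⟨a, ha, hax⟩, hxv⟩ := hx
          simp only [delta] at hax hM
          split_ifs at hax hM <;> omega
        have h1 := Finset.card_le_card hs
        have hs2 : Finset.Icc 1 (min k v) ⊆ ((Finset.Icc 1 k).image lam).filter (· ≤ v) ∪
            (Finset.Icc 1 k \ (Finset.Icc 1 k).image lam) := by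
          intro x hx
          rw [Finset.mem_Icc] at hx
          by_cases hc : x ∈ (Finset.Icc 1 k).image lam
          · exact Finset.mem_union_left _ (Finset.mem_filter.2 ⟨hc, by omega⟩)
          · exact Finset.mem_union_right _ (Finset.mem_sdiff.2 ⟨by simp; omega, hc⟩)
        have h2 := (Finset.card_le_card hs2).trans (Finset.card_union_le _ _)
        rw [Nat.card_Icc] at h1 h2
        omega
  obtain ⟨p, hp, hpmax⟩ := Finset.exists_max_image (Finset.Icc 1 m) lam ⟨1, by simp; omega⟩
  have hp1 := Finset.mem_Icc.1 (hW1 p hp)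
  have hp' := Finset.mem_Icc.1 hp
  by_cases hc : lam p ≤ 2*n+2-m
  · refine ⟨1, le_rfl, hm, hgen 1 (2*n+2-m) le_rfl hm (by simp [delta]) ?_ ?_⟩
    · intro i hi
      exact (hpmax i hi).trans hc
    · intro k _ _ h; omega
  · refine ⟨2*n+3-lam p, by omega, by omega, hgen _ (lam p) (by omega) (by omega) ?_ hpmax ?_⟩
    · simp only [delta, if_true]
      split_ifs <;> omega
    · intro k hk1 hk _ hjk hmem
      obtain ⟨a, ha, hap⟩ := Finset.mem_image.1 hmem
      rw [Finset.mem_Icc] at ha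
      exact hW3 a (by simp; omega) p hp (by omega)

/-- Proposition `Prop:crvnbd`, combinatorial form: letting `S` be the set of
`λ ∈ W^odd` reachable from the identity coset by a chain of degree `d ≤ (1^m)`, the maximal
elements of `S` for the order `⪯` are exactly `δ¹, δ², …, δᵐ`. -/
theorem maximal_elements (n m : ℕ) (hn : 1 ≤ n) (hm : 1 ≤ m) (hmn : m ≤ n)
    (lam : ℕ → ℕ) :
    ((Wodd n m lam ∧
      (∃ L : List OddRoot, IsChainTo n m L lam ∧ ∀ k ∈ Finset.Icc 1 m, chainDeg L k ≤ 1) ∧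
      (∀ mu : ℕ → ℕ, Wodd n m mu →
        (∃ L : List OddRoot, IsChainTo n m L mu ∧ ∀ k ∈ Finset.Icc 1 m, chainDeg L k ≤ 1) →
        Dominates m lam mu → Dominates m mu lam))
    ↔ ∃ j, 1 ≤ j ∧ j ≤ m ∧ ∀ i ∈ Finset.Icc 1 m, lam i = delta n m j i) := by
  constructor
  · rintro ⟨hW, ⟨L, hL, hd⟩, hmax⟩
    obtain ⟨j, hj, hjm, hdom⟩ := exists_delta_ge n m hm hmn lam hW L hL hd
    have hdW := delta_wodd n m j hm hmn hj hjm
    exact ⟨j, hj, hjm, dominates_antisymm m _ _ hW.2.1 hdW.2.1 hdom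
      (hmax _ hdW (delta_chain n m j hm hmn hj hjm) hdom)⟩
  · rintro ⟨j, hj, hjm, he⟩
    have hdW := delta_wodd n m j hm hmn hj hjm
    refine ⟨⟨?_, ?_, ?_⟩, ?_, ?_⟩
    · intro i hi
      rw [he i hi]
      exact hdW.1 i hi
    · intro i hi k hk
      rw [he i hi, he k hk]
      exact hdW.2.1 i hi k hk
    · intro i hi k hk
      rw [he i hi, he k hk]
      exact hdW.2.2 i hi k hk
    · obtain ⟨L, hL, hd⟩ := delta_chain n m j hm hmn hj hjm
      exact ⟨L, ⟨hL.1, fun i hi => (hL.2 i hi).trans (he i hi).symm⟩, hd⟩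
    · rintro mu hmu ⟨L, hL, hd⟩ hdom
      obtain ⟨j', hj', hjm', hdom'⟩ := exists_delta_ge n m hm hmn mu hmu L hL hd
      have h1 : Dominates m lam (delta n m j') := fun k hk i hi =>
        (hdom k hk i hi).trans (hdom' k hk i hi)
      have h2 := dominates_congr m _ _ _ _ he (fun i _ => rfl) h1
      have h3 := delta_incomp n m j j' hmn hj hjm hj' hjm' h2
      subst h3
      exact dominates_congr m _ _ _ _ (fun i _ => rfl) (fun i hi => (he i hi).symm) hdom'
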